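/- arXiv:2408.09862 — 2 statements merged into one kernel-verified Lean document; each statement's English description precedes it below -/
import Mathlib

section
/- Let n ≥ 1, p > 0, and let u : ℝ × ℝⁿ → ℂ be a smooth solution of the defocusing nonlinear Schrödinger equation i∂_t u + Δ_x u = |u|^p u. Assume u is exponentially localized, i.e. there exist C, γ > 0 such that |∂^α u(t,x)| ≤ C e^{-γ|x|} for all (t,x) and all space-time derivatives ∂^α of order at most 2. If u is time-periodic, i.e. there exists T > 0 with u(t+T,x) = u(t,x) for all (t,x), then u is identically zero. (In particular, the defocusing NLS admits no breather solutions.) -/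
open MeasureTheory Real Complex Function

/-- Partial derivative in the `j`-th coordinate direction. -/
noncomputable def pd {n : ℕ} (f : EuclideanSpace ℝ (Fin n) → ℂ) (j : Fin n)
    (x : EuclideanSpace ℝ (Fin n)) : ℂ :=
  fderiv ℝ f x (EuclideanSpace.single j 1)

/-- Spatial Laplacian. -/
noncomputable def lap {n : ℕ} (f : EuclideanSpace ℝ (Fin n) → ℂ)
    (x : EuclideanSpace ℝ (Fin n)) : ℂ :=
  ∑ j, pd (fun y => pd f j y) j x

/-- A continuous function on space-time which decays exponentially in space, uniformly in time. -/
def UniformExpDecay {E : Type*} [NormedAddCommGroup E] (f : ℝ × E → ℝ) : Prop :=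
  Continuous f ∧ ∃ γ > 0, ∃ C, ∀ t x, |f (t, x)| ≤ C * Real.exp (-γ * ‖x‖)

namespace UniformExpDecay

section Algebra

variable {E : Type*} [NormedAddCommGroup E] {f g : ℝ × E → ℝ}

theorem const_mul (hf : UniformExpDecay f) (c : ℝ) : UniformExpDecay fun z => c * f z := by
  obtain ⟨hc, γ, hγ, C, h⟩ := hf
  refine ⟨by fun_prop, γ, hγ, |c| * C, fun t x => ?_⟩
  rw [abs_mul, mul_assoc]
  exact mul_le_mul_of_nonneg_left (h t x) (abs_nonneg c)

theorem add (hf : UniformExpDecay f) (hg : UniformExpDecay g) :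
    UniformExpDecay fun z => f z + g z := by
  obtain ⟨hc, γ, hγ, C, h⟩ := hf
  obtain ⟨hc', γ', hγ', C', h'⟩ := hg
  refine ⟨by fun_prop, min γ γ', lt_min hγ hγ', |C| + |C'|, fun t x => ?_⟩
  have h1 : Real.exp (-γ * ‖x‖) ≤ Real.exp (-min γ γ' * ‖x‖) :=
    Real.exp_le_exp.2 (mul_le_mul_of_nonneg_right (neg_le_neg (min_le_left _ _)) (norm_nonneg x))
  have h2 : Real.exp (-γ' * ‖x‖) ≤ Real.exp (-min γ γ' * ‖x‖) :=
    Real.exp_le_exp.2 (mul_le_mul_of_nonneg_right (neg_le_neg (min_le_right _ _)) (norm_nonneg x))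
  calc |f (t, x) + g (t, x)| ≤ |f (t, x)| + |g (t, x)| := abs_add_le _ _
    _ ≤ C * Real.exp (-γ * ‖x‖) + C' * Real.exp (-γ' * ‖x‖) := add_le_add (h t x) (h' t x)
    _ ≤ |C| * Real.exp (-γ * ‖x‖) + |C'| * Real.exp (-γ' * ‖x‖) := by
      gcongr <;> exact le_abs_self _
    _ ≤ |C| * Real.exp (-min γ γ' * ‖x‖) + |C'| * Real.exp (-min γ γ' * ‖x‖) := by gcongr
    _ = _ := by ring

theorem sub (hf : UniformExpDecay f) (hg : UniformExpDecay g) :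
    UniformExpDecay fun z => f z - g z := by
  simpa [sub_eq_add_neg] using hf.add (hg.const_mul (-1))

theorem sum {ι : Type*} {s : Finset ι} {F : ι → ℝ × E → ℝ} (h : ∀ i, UniformExpDecay (F i)) :
    UniformExpDecay fun z => ∑ i ∈ s, F i z := by
  classical
  induction s using Finset.induction_on with
  | empty => exact ⟨by simpa using continuous_const, 1, one_pos, 0, by simp⟩
  | insert i s hi ih => simpa [Finset.sum_insert hi] using (h i).add ih

theorem mul_of_bound (hf : UniformExpDecay f) (hg : Continuous g)
    (hb : ∃ D, ∀ t x, |g (t, x)| ≤ D * (1 + ‖x‖)) : UniformExpDecay fun z => g z * f z := by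
  obtain ⟨hc, γ, hγ, C, h⟩ := hf
  obtain ⟨D, hD⟩ := hb
  refine ⟨by fun_prop, γ / 2, by positivity, |D| * (1 + 2 / γ) * |C|, fun t x => ?_⟩
  have h1 : 1 + ‖x‖ ≤ (1 + 2 / γ) * Real.exp (γ / 2 * ‖x‖) := by
    have h2 := Real.add_one_le_exp (γ / 2 * ‖x‖)
    have h3 : 1 ≤ Real.exp (γ / 2 * ‖x‖) := Real.one_le_exp (by positivity)
    have h4 : ‖x‖ ≤ 2 / γ * Real.exp (γ / 2 * ‖x‖) := by
      calc ‖x‖ = 2 / γ * (γ / 2 * ‖x‖) := by field_simp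
        _ ≤ _ := by gcongr; linarith
    linarith
  have h5 : Real.exp (γ / 2 * ‖x‖) * Real.exp (-γ * ‖x‖) = Real.exp (-(γ / 2) * ‖x‖) := by
    rw [← Real.exp_add]; ring_nf
  calc |g (t, x) * f (t, x)| = |g (t, x)| * |f (t, x)| := abs_mul _ _
    _ ≤ (|D| * ((1 + 2 / γ) * Real.exp (γ / 2 * ‖x‖))) * (|C| * Real.exp (-γ * ‖x‖)) := by
      gcongr
      · exact (hD t x).trans (by gcongr; exact le_abs_self D)
      · exact (h t x).trans (by gcongr; exact le_abs_self C)
    _ = _ := by rw [← h5]; ring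

theorem mul (hf : UniformExpDecay f) (hg : UniformExpDecay g) :
    UniformExpDecay fun z => f z * g z := by
  refine hg.mul_of_bound hf.1 ?_
  obtain ⟨-, γ, hγ, C, h⟩ := hf
  refine ⟨|C|, fun t x => (h t x).trans ?_⟩
  have h1 : Real.exp (-γ * ‖x‖) ≤ 1 := Real.exp_le_one_iff.2 (by nlinarith [norm_nonneg x])
  have h2 := norm_nonneg x
  calc C * Real.exp (-γ * ‖x‖) ≤ |C| * Real.exp (-γ * ‖x‖) := by gcongr; exact le_abs_self C
    _ ≤ _ := by gcongr; linarith

theorem rpow (hf : UniformExpDecay f) (h0 : ∀ z, 0 ≤ f z) {q : ℝ} (hq : 0 < q) :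
    UniformExpDecay fun z => f z ^ q := by
  obtain ⟨hc, γ, hγ, C, h⟩ := hf
  refine ⟨hc.rpow_const fun _ => Or.inr hq.le, γ * q, by positivity, |C| ^ q, fun t x => ?_⟩
  rw [abs_of_nonneg (Real.rpow_nonneg (h0 _) _)]
  calc f (t, x) ^ q ≤ (|C| * Real.exp (-γ * ‖x‖)) ^ q := by
        refine Real.rpow_le_rpow (h0 _) (((le_abs_self _).trans (h t x)).trans ?_) hq.le
        gcongr
        exact le_abs_self C
    _ = _ := by
      rw [Real.mul_rpow (abs_nonneg _) (Real.exp_pos _).le, ← Real.exp_mul]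
      ring_nf

end Algebra

variable {n : ℕ} {f : ℝ × EuclideanSpace ℝ (Fin n) → ℝ}

theorem coord_mul (hf : UniformExpDecay f) (j : Fin n) :
    UniformExpDecay fun z : ℝ × EuclideanSpace ℝ (Fin n) => z.2 j * f z := by
  refine hf.mul_of_bound (by fun_prop) ⟨1, fun t x => ?_⟩
  have := PiLp.norm_apply_le x j
  rw [Real.norm_eq_abs] at this
  linarith

theorem exists_integrable_bound (hf : UniformExpDecay f) :
    ∃ b : EuclideanSpace ℝ (Fin n) → ℝ, Integrable b ∧ ∀ t x, |f (t, x)| ≤ b x := by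
  obtain ⟨hc, γ, hγ, C, h⟩ := hf
  refine ⟨fun x => C * Real.exp (-γ * ‖x‖), Integrable.const_mul ?_ C, h⟩
  rcases Nat.eq_zero_or_pos n with rfl | hn
  · exact Integrable.of_finite
  have : Nontrivial (EuclideanSpace ℝ (Fin n)) :=
    Module.nontrivial_of_finrank_pos (R := ℝ) (by simpa using hn)
  rw [integrable_fun_norm_addHaar volume (f := fun s => Real.exp (-γ * s))]
  have := integrableOn_rpow_mul_exp_neg_mul_rpow (p := 1) (s := (n - 1 : ℕ)) (b := γ)
    (by linarith [(Nat.cast_nonneg (n - 1) : (0 : ℝ) ≤ ((n - 1 : ℕ) : ℝ))]) one_pos hγ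
  simpa using this

theorem integrable (hf : UniformExpDecay f) (t : ℝ) : Integrable fun x => f (t, x) := by
  obtain ⟨b, hb, h⟩ := hf.exists_integrable_bound
  exact hb.mono' (hf.1.comp (by fun_prop)).aestronglyMeasurable
    (Filter.Eventually.of_forall fun x => h t x)

/-- Differentiation under the integral sign. -/
theorem hasDerivAt_integral {f' : ℝ × EuclideanSpace ℝ (Fin n) → ℝ} (hf : UniformExpDecay f)
    (hf' : UniformExpDecay f')
    (hd : ∀ t x, HasDerivAt (fun s => f (s, x)) (f' (t, x)) t) (t : ℝ) :
    HasDerivAt (fun s => ∫ x, f (s, x)) (∫ x, f' (t, x)) t := by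
  obtain ⟨b, hb, h⟩ := hf'.exists_integrable_bound
  exact (hasDerivAt_integral_of_dominated_loc_of_deriv_le Filter.univ_mem
    (Filter.Eventually.of_forall fun s => (hf.integrable s).aestronglyMeasurable) (hf.integrable t)
    (hf'.integrable t).aestronglyMeasurable
    (Filter.Eventually.of_forall fun x s _ => h s x) hb
    (Filter.Eventually.of_forall fun x s _ => hd s x)).2

/-- The integral of a directional derivative vanishes. -/
theorem integral_lineDeriv_eq_zero {f' : ℝ × EuclideanSpace ℝ (Fin n) → ℝ}
    (hf : UniformExpDecay f) (hf' : UniformExpDecay f') (t : ℝ) (v : EuclideanSpace ℝ (Fin n))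
    (hd : ∀ x, HasDerivAt (fun s : ℝ => f ((t, x) + s • ((0 : ℝ), v))) (f' (t, x)) 0) :
    ∫ x, f' (t, x) = 0 := by
  have := integral_bilinear_hasLineDerivAt_right_eq_neg_left_of_integrable
    (μ := (volume : Measure (EuclideanSpace ℝ (Fin n)))) (v := v)
    (f := fun _ => (1 : ℝ)) (f' := fun _ => (0 : ℝ)) (g := fun x => f (t, x))
    (g' := fun x => f' (t, x)) (B := ContinuousLinearMap.mul ℝ ℝ)
    (by simp) (by simpa using hf'.integrable t) (by simpa using hf.integrable t)
    (fun x _ => by simpa [HasLineDerivAt] using hasDerivAt_const (0 : ℝ) (1 : ℝ))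
    (fun x _ => by simpa [HasLineDerivAt] using hd x)
  simpa using this

end UniformExpDecay

/-- The pointwise algebraic identity behind the virial identity. Here `a, b` are the real and
imaginary parts of the solution, `A j, B j` their spatial, `a', b'` their time derivatives. -/
theorem virial_density_identity {n : ℕ} (x A B A' B' : Fin n → ℝ) (AA BB : Fin n → Fin n → ℝ)
    (hA : ∀ j k, AA j k = AA k j) (hB : ∀ j k, BB j k = BB k j) (a b a' b' ρ S c : ℝ)
    (h1 : -b' + ∑ j, AA j j = ρ * a) (h2 : a' + ∑ j, BB j j = ρ * b)
    (hS : S = ρ * (a * a + b * b)) :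
    ∑ j, x j * (a' * B j + a * B' j - (b' * A j + b * A' j)) =
      2 * ∑ j, (A j * A j + B j * B j) + n * (1 - c) * S +
      ∑ j, ((a * b' - b * a') + x j * (A j * b' - B j * a' + (a * B' j - b * A' j))
        - 2 * (A j * A j + B j * B j)
        - 2 * ∑ k, x k * (AA j j * A k + A j * AA j k + (BB j j * B k + B j * BB j k))
        + ∑ k, (A k * A k + B k * B k)
        + 2 * (x j * ∑ k, (A k * AA j k + B k * BB j k))
        + c * S + 2 * (x j * (ρ * (a * A j + b * B j)))
        - n * (A j * A j + B j * B j) - n * (a * AA j j + b * BB j j)) := by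
  have hsw : ∑ j, ∑ k, x k * (A j * AA j k + B j * BB j k) =
      ∑ j, x j * ∑ k, (A k * AA j k + B k * BB j k) := by
    rw [Finset.sum_comm]
    refine Finset.sum_congr rfl fun j _ => ?_
    rw [Finset.mul_sum]
    exact Finset.sum_congr rfl fun k _ => by rw [hA k j, hB k j]
  have hlap : ∑ j, ∑ k, x k * (AA j j * A k + BB j j * B k) =
      (∑ j, AA j j) * (∑ k, x k * A k) + (∑ j, BB j j) * (∑ k, x k * B k) := by
    simp only [Finset.sum_mul_sum, ← Finset.sum_add_distrib]
    exact Finset.sum_congr rfl fun j _ => Finset.sum_congr rfl fun k _ => by ring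
  have hl : ∑ j, x j * (a' * B j + a * B' j - (b' * A j + b * A' j)) =
      a' * ∑ j, x j * B j + a * ∑ j, x j * B' j - b' * ∑ j, x j * A j
        - b * ∑ j, x j * A' j := by
    simp only [Finset.mul_sum, ← Finset.sum_add_distrib, ← Finset.sum_sub_distrib]
    exact Finset.sum_congr rfl fun j _ => by ring
  have hr1 : ∑ j, x j * (A j * b' - B j * a' + (a * B' j - b * A' j)) =
      b' * ∑ j, x j * A j - a' * ∑ j, x j * B j + a * ∑ j, x j * B' j
        - b * ∑ j, x j * A' j := by
    simp only [Finset.mul_sum, ← Finset.sum_add_distrib, ← Finset.sum_sub_distrib]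
    exact Finset.sum_congr rfl fun j _ => by ring
  have hr2 : ∑ j, x j * (ρ * (a * A j + b * B j)) =
      ρ * (a * ∑ j, x j * A j + b * ∑ j, x j * B j) := by
    simp only [Finset.mul_sum, ← Finset.sum_add_distrib]
    exact Finset.sum_congr rfl fun j _ => by ring
  have hr3 : ∑ j, (a * AA j j + b * BB j j) = a * ∑ j, AA j j + b * ∑ j, BB j j := by
    simp only [Finset.mul_sum, ← Finset.sum_add_distrib]
  have hr4 : ∑ j, ∑ k, x k * (AA j j * A k + A j * AA j k + (BB j j * B k + B j * BB j k)) =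
      ∑ j, ∑ k, x k * (AA j j * A k + BB j j * B k) +
        ∑ j, ∑ k, x k * (A j * AA j k + B j * BB j k) := by
    simp only [← Finset.sum_add_distrib]
    exact Finset.sum_congr rfl fun j _ => Finset.sum_congr rfl fun k _ => by ring
  have hcomb : ∀ (k₁ k₂ E : ℝ) (f₁ f₂ f₃ f₄ f₅ f₆ : Fin n → ℝ),
      ∑ j, (k₁ + f₁ j - 2 * f₂ j - 2 * f₃ j + E + 2 * f₄ j + k₂ + 2 * f₅ j - n * f₂ j
        - n * f₆ j) = n * k₁ + ∑ j, f₁ j - 2 * ∑ j, f₂ j - 2 * ∑ j, f₃ j + n * E + 2 * ∑ j, f₄ j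
        + n * k₂ + 2 * ∑ j, f₅ j - n * ∑ j, f₂ j - n * ∑ j, f₆ j := fun _ _ _ _ _ _ _ _ _ => by
    simp only [Finset.sum_add_distrib, Finset.sum_sub_distrib, ← Finset.mul_sum,
      Finset.sum_const, Finset.card_univ, Fintype.card_fin, nsmul_eq_mul]
  rw [hcomb, hl, hr1, hr2, hr3, hr4, hsw, hlap, hS]
  obtain rfl : b' = ∑ j, AA j j - ρ * a := by linarith
  obtain rfl : a' = ρ * b - ∑ j, BB j j := by linarith
  ring

/-- The derivative of `f` in the direction `v`, as a function of the base point. -/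
noncomputable def dirDeriv {V : Type*} [NormedAddCommGroup V] [NormedSpace ℝ V] (v : V)
    (f : V → ℝ) (z : V) : ℝ :=
  fderiv ℝ f z v

/-- A smooth function all of whose derivatives of order at most two are exponentially decaying. -/
structure HasDecayingJet {E : Type*} [NormedAddCommGroup E] [NormedSpace ℝ E]
    (f : ℝ × E → ℝ) : Prop where
  smooth : ContDiff ℝ (⊤ : ℕ∞) f
  decay : UniformExpDecay f
  decay_dirDeriv : ∀ v, UniformExpDecay (dirDeriv v f)
  decay_dirDeriv_dirDeriv : ∀ v w, UniformExpDecay (dirDeriv v (dirDeriv w f))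

theorem hasFDerivAt_fderiv_apply {V F : Type*} [NormedAddCommGroup V] [NormedSpace ℝ V]
    [NormedAddCommGroup F] [NormedSpace ℝ F] {U : V → F} (hU : ContDiff ℝ (⊤ : ℕ∞) U) (w z : V) :
    HasFDerivAt (fun y => fderiv ℝ U y w) ((fderiv ℝ (fderiv ℝ U) z).flip w) z := by
  have hU' : ContDiff ℝ (⊤ : ℕ∞) (fderiv ℝ U) := hU.fderiv_right (by simp)
  simpa using ((hU'.differentiable (by simp)) z).hasFDerivAt.clm_apply (hasFDerivAt_const w z)

section DirDeriv

variable {V : Type*} [NormedAddCommGroup V] [NormedSpace ℝ V] {f : V → ℝ}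

theorem contDiff_dirDeriv (hf : ContDiff ℝ (⊤ : ℕ∞) f) (v : V) :
    ContDiff ℝ (⊤ : ℕ∞) (dirDeriv v f) :=
  (hf.fderiv_right (m := (⊤ : ℕ∞)) (by simp)).clm_apply contDiff_const

theorem dirDeriv_dirDeriv_apply (hf : ContDiff ℝ (⊤ : ℕ∞) f) (v w z : V) :
    dirDeriv v (dirDeriv w f) z = fderiv ℝ (fderiv ℝ f) z v w :=
  congrArg (fun L => L v) (hasFDerivAt_fderiv_apply hf w z).fderiv

theorem dirDeriv_comm (hf : ContDiff ℝ (⊤ : ℕ∞) f) (v w : V) :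
    dirDeriv v (dirDeriv w f) = dirDeriv w (dirDeriv v f) := by
  ext z
  rw [dirDeriv_dirDeriv_apply hf, dirDeriv_dirDeriv_apply hf]
  have h2 : minSmoothness ℝ 2 ≤ ((⊤ : ℕ∞) : WithTop ℕ∞) := by
    simpa using WithTop.coe_le_coe.2 (le_top : (2 : ℕ∞) ≤ ⊤)
  exact hf.contDiffAt.isSymmSndFDerivAt h2 v w

theorem hasDerivAt_comp_line (hf : ContDiff ℝ (⊤ : ℕ∞) f) (z v : V) :
    HasDerivAt (fun s : ℝ => f (z + s • v)) (dirDeriv v f z) 0 :=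
  ((hf.differentiable (by simp)) z).hasFDerivAt.hasLineDerivAt v

end DirDeriv

theorem hasDerivAt_time {E : Type*} [NormedAddCommGroup E] [NormedSpace ℝ E] {F : Type*}
    [NormedAddCommGroup F] [NormedSpace ℝ F] {f : ℝ × E → F}
    (hf : ContDiff ℝ (⊤ : ℕ∞) f) (t : ℝ) (x : E) :
    HasDerivAt (fun s => f (s, x)) (fderiv ℝ f (t, x) (1, 0)) t :=
  ((hf.differentiable (by simp)) (t, x)).hasFDerivAt.comp_hasDerivAt t
    ((hasDerivAt_id t).prodMk (hasDerivAt_const t x))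

theorem dirDeriv_clm_comp {V : Type*} [NormedAddCommGroup V] [NormedSpace ℝ V] {U : V → ℂ}
    (hU : ContDiff ℝ (⊤ : ℕ∞) U) (L : ℂ →L[ℝ] ℝ) (v z : V) :
    dirDeriv v (fun z => L (U z)) z = L (fderiv ℝ U z v) := by
  have := (L.hasFDerivAt.comp z ((hU.differentiable (by simp)) z).hasFDerivAt).fderiv
  exact congrArg (fun L => L v) this

theorem dirDeriv_dirDeriv_clm_comp {V : Type*} [NormedAddCommGroup V] [NormedSpace ℝ V]
    {U : V → ℂ} (hU : ContDiff ℝ (⊤ : ℕ∞) U) (L : ℂ →L[ℝ] ℝ) (v w z : V) :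
    dirDeriv v (dirDeriv w fun z => L (U z)) z = L (fderiv ℝ (fderiv ℝ U) z v w) := by
  rw [show dirDeriv w (fun z => L (U z)) = fun z => L (fderiv ℝ U z w) from
    funext (dirDeriv_clm_comp hU L w)]
  exact congrArg (fun L => L v) (L.hasFDerivAt.comp z (hasFDerivAt_fderiv_apply hU w z)).fderiv

theorem hasDecayingJet_clm_comp {E : Type*} [NormedAddCommGroup E] [NormedSpace ℝ E]
    {U : ℝ × E → ℂ} (hU : ContDiff ℝ (⊤ : ℕ∞) U) {C γ : ℝ} (hγ : 0 < γ)
    (hb : ∀ k : ℕ, k ≤ 2 → ∀ t x, ‖iteratedFDeriv ℝ k U (t, x)‖ ≤ C * Real.exp (-γ * ‖x‖))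
    (L : ℂ →L[ℝ] ℝ) : HasDecayingJet fun z => L (U z) := by
  have hs : ContDiff ℝ (⊤ : ℕ∞) fun z => L (U z) := L.contDiff.comp hU
  refine ⟨hs, ⟨hs.continuous, γ, hγ, ‖L‖ * C, fun t x => ?_⟩,
    fun v => ⟨(contDiff_dirDeriv hs v).continuous, γ, hγ, ‖L‖ * (C * ‖v‖), fun t x => ?_⟩,
    fun v w => ⟨(contDiff_dirDeriv (contDiff_dirDeriv hs w) v).continuous, γ, hγ,
      ‖L‖ * (C * ‖v‖ * ‖w‖), fun t x => ?_⟩⟩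
  · have := hb 0 (by norm_num) t x
    rw [norm_iteratedFDeriv_zero] at this
    calc |L (U (t, x))| ≤ ‖L‖ * ‖U (t, x)‖ := L.le_opNorm _
      _ ≤ ‖L‖ * (C * Real.exp (-γ * ‖x‖)) := by gcongr
      _ = _ := by ring
  · have := hb 1 (by norm_num) t x
    rw [norm_iteratedFDeriv_one] at this
    rw [dirDeriv_clm_comp hU]
    calc |L (fderiv ℝ U (t, x) v)| ≤ ‖L‖ * ‖fderiv ℝ U (t, x) v‖ := L.le_opNorm _
      _ ≤ ‖L‖ * (‖fderiv ℝ U (t, x)‖ * ‖v‖) := by gcongr; exact ContinuousLinearMap.le_opNorm _ _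
      _ ≤ ‖L‖ * (C * Real.exp (-γ * ‖x‖) * ‖v‖) := by gcongr
      _ = _ := by ring
  · have := hb 2 le_rfl t x
    rw [← norm_iteratedFDeriv_fderiv, norm_iteratedFDeriv_one] at this
    rw [dirDeriv_dirDeriv_clm_comp hU]
    calc |L (fderiv ℝ (fderiv ℝ U) (t, x) v w)| ≤ ‖L‖ * ‖fderiv ℝ (fderiv ℝ U) (t, x) v w‖ :=
          L.le_opNorm _
      _ ≤ ‖L‖ * (‖fderiv ℝ (fderiv ℝ U) (t, x)‖ * ‖v‖ * ‖w‖) := by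
        gcongr; exact ContinuousLinearMap.le_opNorm₂ _ _ _
      _ ≤ ‖L‖ * (C * Real.exp (-γ * ‖x‖) * ‖v‖ * ‖w‖) := by gcongr
      _ = _ := by ring

section Virial

variable {n : ℕ} {a b : ℝ × EuclideanSpace ℝ (Fin n) → ℝ}

/-- The unit time vector in space-time. -/
abbrev timeDir (n : ℕ) : ℝ × EuclideanSpace ℝ (Fin n) := (1, 0)

/-- The `j`-th spatial coordinate vector in space-time. -/
noncomputable abbrev spaceDir {n : ℕ} (j : Fin n) : ℝ × EuclideanSpace ℝ (Fin n) :=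
  (0, EuclideanSpace.single j 1)

/-- The density `Im ⟨x, ū ∇u⟩` of the virial function of `u = a + i b`. -/
noncomputable def virialDensity (a b : ℝ × EuclideanSpace ℝ (Fin n) → ℝ)
    (z : ℝ × EuclideanSpace ℝ (Fin n)) : ℝ :=
  ∑ j, z.2 j * (a z * dirDeriv (spaceDir j) b z - b z * dirDeriv (spaceDir j) a z)

/-- The time derivative of `virialDensity`. -/
noncomputable def virialDensityDeriv (a b : ℝ × EuclideanSpace ℝ (Fin n) → ℝ)
    (z : ℝ × EuclideanSpace ℝ (Fin n)) : ℝ :=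
  ∑ j, z.2 j *
    (dirDeriv (timeDir n) a z * dirDeriv (spaceDir j) b z +
        a z * dirDeriv (timeDir n) (dirDeriv (spaceDir j) b) z -
      (dirDeriv (timeDir n) b z * dirDeriv (spaceDir j) a z +
        b z * dirDeriv (timeDir n) (dirDeriv (spaceDir j) a) z))

/-- The components of the flux in the local virial identity. -/
noncomputable def virialFlux (p : ℝ) (a b : ℝ × EuclideanSpace ℝ (Fin n) → ℝ) (j : Fin n)
    (z : ℝ × EuclideanSpace ℝ (Fin n)) : ℝ :=
  z.2 j * (a z * dirDeriv (timeDir n) b z - b z * dirDeriv (timeDir n) a z)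
    - 2 * ∑ k, z.2 k * (dirDeriv (spaceDir j) a z * dirDeriv (spaceDir k) a z +
        dirDeriv (spaceDir j) b z * dirDeriv (spaceDir k) b z)
    + z.2 j * ∑ k, (dirDeriv (spaceDir k) a z * dirDeriv (spaceDir k) a z +
        dirDeriv (spaceDir k) b z * dirDeriv (spaceDir k) b z)
    + 2 / (p + 2) * (z.2 j * (a z * a z + b z * b z) ^ (p / 2 + 1))
    - n * (a z * dirDeriv (spaceDir j) a z + b z * dirDeriv (spaceDir j) b z)

/-- The derivative of the `j`-th flux component in the `j`-th direction. -/
noncomputable def virialFluxDeriv (p : ℝ) (a b : ℝ × EuclideanSpace ℝ (Fin n) → ℝ) (j : Fin n)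
    (z : ℝ × EuclideanSpace ℝ (Fin n)) : ℝ :=
  let A := fun k => dirDeriv (spaceDir k) a z
  let B := fun k => dirDeriv (spaceDir k) b z
  let AA := fun k => dirDeriv (spaceDir j) (dirDeriv (spaceDir k) a) z
  let BB := fun k => dirDeriv (spaceDir j) (dirDeriv (spaceDir k) b) z
  let a' := dirDeriv (timeDir n) a z
  let b' := dirDeriv (timeDir n) b z
  (a z * b' - b z * a')
    + z.2 j * (A j * b' - B j * a' + (a z * dirDeriv (timeDir n) (dirDeriv (spaceDir j) b) z -
        b z * dirDeriv (timeDir n) (dirDeriv (spaceDir j) a) z))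
    - 2 * (A j * A j + B j * B j)
    - 2 * ∑ k, z.2 k * (AA j * A k + A j * AA k + (BB j * B k + B j * BB k))
    + ∑ k, (A k * A k + B k * B k)
    + 2 * (z.2 j * ∑ k, (A k * AA k + B k * BB k))
    + 2 / (p + 2) * (a z * a z + b z * b z) ^ (p / 2 + 1)
    + 2 * (z.2 j * ((a z * a z + b z * b z) ^ (p / 2) * (a z * A j + b z * B j)))
    - n * (A j * A j + B j * B j) - n * (a z * AA j + b z * BB j)

/-- The nonnegative source term in the local virial identity. -/
noncomputable def virialProduction (p : ℝ) (a b : ℝ × EuclideanSpace ℝ (Fin n) → ℝ)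
    (z : ℝ × EuclideanSpace ℝ (Fin n)) : ℝ :=
  2 * ∑ j, (dirDeriv (spaceDir j) a z * dirDeriv (spaceDir j) a z +
      dirDeriv (spaceDir j) b z * dirDeriv (spaceDir j) b z) +
    n * (1 - 2 / (p + 2)) * (a z * a z + b z * b z) ^ (p / 2 + 1)

theorem virialProduction_nonneg {p : ℝ} (hp : 0 < p) (z : ℝ × EuclideanSpace ℝ (Fin n)) :
    0 ≤ virialProduction p a b z := by
  have h1 : 0 ≤ 1 - 2 / (p + 2) := by
    rw [sub_nonneg, div_le_one (by positivity)]; linarith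
  have h2 := Finset.sum_nonneg fun (j : Fin n) (_ : j ∈ Finset.univ) =>
    add_nonneg (mul_self_nonneg (dirDeriv (spaceDir j) a z))
      (mul_self_nonneg (dirDeriv (spaceDir j) b z))
  have h3 : 0 ≤ a z * a z + b z * b z := add_nonneg (mul_self_nonneg _) (mul_self_nonneg _)
  unfold virialProduction
  positivity

theorem hasDerivAt_virialDensity (ha : HasDecayingJet a) (hb : HasDecayingJet b) (t : ℝ)
    (x : EuclideanSpace ℝ (Fin n)) :
    HasDerivAt (fun s => virialDensity a b (s, x)) (virialDensityDeriv a b (t, x)) t := by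
  refine HasDerivAt.fun_sum fun j _ => HasDerivAt.const_mul (x j) ?_
  exact ((hasDerivAt_time ha.smooth t x).mul
    (hasDerivAt_time (contDiff_dirDeriv hb.smooth _) t x)).sub
    ((hasDerivAt_time hb.smooth t x).mul (hasDerivAt_time (contDiff_dirDeriv ha.smooth _) t x))

theorem uniformExpDecay_sq_add_sq (ha : HasDecayingJet a) (hb : HasDecayingJet b) {q : ℝ}
    (hq : 0 < q) : UniformExpDecay fun z => (a z * a z + b z * b z) ^ q :=
  ((ha.decay.mul ha.decay).add (hb.decay.mul hb.decay)).rpow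
    (fun _ => add_nonneg (mul_self_nonneg _) (mul_self_nonneg _)) hq

theorem uniformExpDecay_virialDensity (ha : HasDecayingJet a) (hb : HasDecayingJet b) :
    UniformExpDecay (virialDensity a b) :=
  .sum fun j => .coord_mul ((ha.decay.mul (hb.decay_dirDeriv _)).sub
    (hb.decay.mul (ha.decay_dirDeriv _))) j

theorem uniformExpDecay_virialDensityDeriv (ha : HasDecayingJet a) (hb : HasDecayingJet b) :
    UniformExpDecay (virialDensityDeriv a b) :=
  .sum fun j => .coord_mul
    ((((ha.decay_dirDeriv _).mul (hb.decay_dirDeriv _)).add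
      (ha.decay.mul (hb.decay_dirDeriv_dirDeriv _ _))).sub
    (((hb.decay_dirDeriv _).mul (ha.decay_dirDeriv _)).add
      (hb.decay.mul (ha.decay_dirDeriv_dirDeriv _ _)))) j

theorem uniformExpDecay_virialProduction (ha : HasDecayingJet a) (hb : HasDecayingJet b) {p : ℝ}
    (hp : 0 < p) : UniformExpDecay (virialProduction p a b) :=
  .add (.const_mul (.sum fun j => ((ha.decay_dirDeriv _).mul (ha.decay_dirDeriv _)).add
      ((hb.decay_dirDeriv _).mul (hb.decay_dirDeriv _))) 2)
    ((uniformExpDecay_sq_add_sq ha hb (by positivity)).const_mul _)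

theorem uniformExpDecay_virialFlux (ha : HasDecayingJet a) (hb : HasDecayingJet b) {p : ℝ}
    (hp : 0 < p) (j : Fin n) : UniformExpDecay (virialFlux p a b j) := by
  have hS := uniformExpDecay_sq_add_sq ha hb (q := p / 2 + 1) (by positivity)
  have hA := fun k : Fin n => ha.decay_dirDeriv (spaceDir k)
  have hB := fun k : Fin n => hb.decay_dirDeriv (spaceDir k)
  exact .sub (.add (.add (.sub
    (.coord_mul ((ha.decay.mul (hb.decay_dirDeriv _)).sub (hb.decay.mul (ha.decay_dirDeriv _))) j)
    (.const_mul (.sum fun k => .coord_mul (((hA j).mul (hA k)).add ((hB j).mul (hB k))) k) 2))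
    (.coord_mul (.sum fun k => ((hA k).mul (hA k)).add ((hB k).mul (hB k))) j))
    (.const_mul (hS.coord_mul j) _))
    (.const_mul ((ha.decay.mul (hA j)).add (hb.decay.mul (hB j))) _)

theorem uniformExpDecay_virialFluxDeriv (ha : HasDecayingJet a) (hb : HasDecayingJet b) {p : ℝ}
    (hp : 0 < p) (j : Fin n) : UniformExpDecay (virialFluxDeriv p a b j) := by
  have hS := uniformExpDecay_sq_add_sq ha hb (q := p / 2 + 1) (by positivity)
  have hρ := uniformExpDecay_sq_add_sq ha hb (q := p / 2) (by positivity)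
  have hA := fun k : Fin n => ha.decay_dirDeriv (spaceDir k)
  have hB := fun k : Fin n => hb.decay_dirDeriv (spaceDir k)
  have hAA := fun k : Fin n => ha.decay_dirDeriv_dirDeriv (spaceDir j) (spaceDir k)
  have hBB := fun k : Fin n => hb.decay_dirDeriv_dirDeriv (spaceDir j) (spaceDir k)
  have ha' := ha.decay_dirDeriv (timeDir n)
  have hb' := hb.decay_dirDeriv (timeDir n)
  have hE := fun k => ((hA k).mul (hA k)).add ((hB k).mul (hB k))
  exact .sub (.sub (.add (.add (.add (.add (.sub (.sub (.add
    (.sub (ha.decay.mul hb') (hb.decay.mul ha'))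
    (.coord_mul ((((hA j).mul hb').sub ((hB j).mul ha')).add
      ((ha.decay.mul (hb.decay_dirDeriv_dirDeriv _ _)).sub
        (hb.decay.mul (ha.decay_dirDeriv_dirDeriv _ _)))) j))
    ((hE j).const_mul 2))
    (.const_mul (.sum fun k => .coord_mul ((((hAA j).mul (hA k)).add ((hA j).mul (hAA k))).add
      (((hBB j).mul (hB k)).add ((hB j).mul (hBB k)))) k) 2))
    (.sum hE))
    (.const_mul (.coord_mul (.sum fun k => ((hA k).mul (hAA k)).add ((hB k).mul (hBB k))) j) 2))
    (hS.const_mul _))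
    (.const_mul (.coord_mul (hρ.mul ((ha.decay.mul (hA j)).add (hb.decay.mul (hB j)))) j) 2))
    (.const_mul (hE j) _))
    (.const_mul ((ha.decay.mul (hAA j)).add (hb.decay.mul (hBB j))) _)

theorem hasDerivAt_virialFlux (ha : HasDecayingJet a) (hb : HasDecayingJet b) {p : ℝ}
    (hp : 0 < p) (j : Fin n) (z : ℝ × EuclideanSpace ℝ (Fin n)) :
    HasDerivAt (fun s : ℝ => virialFlux p a b j (z + s • spaceDir j))
      (virialFluxDeriv p a b j z) 0 := by
  have hx : ∀ k, HasDerivAt (fun s : ℝ => (z + s • spaceDir j).2 k) (if k = j then 1 else 0) 0 :=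
    fun k => by
      have := ((hasDerivAt_id (0 : ℝ)).mul_const (if k = j then (1 : ℝ) else 0)).const_add (z.2 k)
      simpa [Pi.single_apply] using this
  have hda := hasDerivAt_comp_line ha.smooth z (spaceDir j)
  have hdb := hasDerivAt_comp_line hb.smooth z (spaceDir j)
  have hdA := fun v => hasDerivAt_comp_line (contDiff_dirDeriv ha.smooth v) z (spaceDir j)
  have hdB := fun v => hasDerivAt_comp_line (contDiff_dirDeriv hb.smooth v) z (spaceDir j)
  have hS := ((hda.mul hda).add (hdb.mul hdb)).rpow_const (p := p / 2 + 1)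
    (Or.inr (by linarith))
  have hsum := HasDerivAt.fun_sum (u := Finset.univ) fun (k : Fin n) _ => (hx k).mul
    (((hdA (spaceDir j)).mul (hdA (spaceDir k))).add ((hdB (spaceDir j)).mul (hdB (spaceDir k))))
  have hE := HasDerivAt.fun_sum (u := Finset.univ) fun (k : Fin n) _ =>
    ((hdA (spaceDir k)).mul (hdA (spaceDir k))).add ((hdB (spaceDir k)).mul (hdB (spaceDir k)))
  have hW := ((((((hx j).mul ((hda.mul (hdB (timeDir n))).sub (hdb.mul (hdA (timeDir n))))).sub
    (hsum.const_mul 2)).add ((hx j).mul hE)).add (((hx j).mul hS).const_mul (2 / (p + 2)))).sub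
    (((hda.mul (hdA (spaceDir j))).add (hdb.mul (hdB (spaceDir j)))).const_mul (n : ℝ)))
  refine hW.congr_deriv ?_
  have h1 : ∀ F G : Fin n → ℝ, ∑ k, ((if k = j then 1 else 0) * F k + z.2 k * G k) =
      F j + ∑ k, z.2 k * G k := fun F G => by simp [Finset.sum_add_distrib]
  have h2 : ∀ f f' g g' : Fin n → ℝ, ∑ k, (f' k * f k + f k * f' k + (g' k * g k + g k * g' k)) =
      2 * ∑ k, (f k * f' k + g k * g' k) := fun f f' g g' => by
    rw [Finset.mul_sum]; exact Finset.sum_congr rfl fun k _ => by ring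
  have h3 : p / 2 + 1 - 1 = p / 2 := by ring
  simp only [virialFluxDeriv, zero_smul, add_zero, Pi.add_apply, Pi.mul_apply, Pi.sub_apply,
    if_true, dirDeriv_comm ha.smooth (timeDir n), dirDeriv_comm hb.smooth (timeDir n)]
  rw [h1, h2, h3]
  field_simp
  ring

theorem integral_virialDensityDeriv (ha : HasDecayingJet a) (hb : HasDecayingJet b) {p : ℝ}
    (hp : 0 < p)
    (h1 : ∀ z, -dirDeriv (timeDir n) b z + ∑ j, dirDeriv (spaceDir j) (dirDeriv (spaceDir j) a) z =
      (a z * a z + b z * b z) ^ (p / 2) * a z)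
    (h2 : ∀ z, dirDeriv (timeDir n) a z + ∑ j, dirDeriv (spaceDir j) (dirDeriv (spaceDir j) b) z =
      (a z * a z + b z * b z) ^ (p / 2) * b z) (t : ℝ) :
    ∫ x, virialDensityDeriv a b (t, x) = ∫ x, virialProduction p a b (t, x) := by
  have hz : ∀ z, virialDensityDeriv a b z =
      virialProduction p a b z + ∑ j, virialFluxDeriv p a b j z := fun z => by
    refine virial_density_identity (fun j => z.2 j) (fun j => dirDeriv (spaceDir j) a z)
      (fun j => dirDeriv (spaceDir j) b z)
      (fun j => dirDeriv (timeDir n) (dirDeriv (spaceDir j) a) z)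
      (fun j => dirDeriv (timeDir n) (dirDeriv (spaceDir j) b) z)
      (fun j k => dirDeriv (spaceDir j) (dirDeriv (spaceDir k) a) z)
      (fun j k => dirDeriv (spaceDir j) (dirDeriv (spaceDir k) b) z)
      (fun j k => congrFun (dirDeriv_comm ha.smooth _ _) z)
      (fun j k => congrFun (dirDeriv_comm hb.smooth _ _) z) _ _ _ _ _ _ _ (h1 z) (h2 z) ?_
    rw [Real.rpow_add_one' (add_nonneg (mul_self_nonneg _) (mul_self_nonneg _)) (by positivity)]
  simp only [hz]
  rw [integral_add ((uniformExpDecay_virialProduction ha hb hp).integrable t)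
    (integrable_finsetSum _ fun j _ => (uniformExpDecay_virialFluxDeriv ha hb hp j).integrable t),
    integral_finsetSum _ fun j _ => (uniformExpDecay_virialFluxDeriv ha hb hp j).integrable t,
    Finset.sum_eq_zero fun j _ => (uniformExpDecay_virialFlux ha hb hp j).integral_lineDeriv_eq_zero
      (uniformExpDecay_virialFluxDeriv ha hb hp j) t (EuclideanSpace.single j 1)
      fun x => hasDerivAt_virialFlux ha hb hp j (t, x), add_zero]

theorem eq_zero_of_periodic (hn : 0 < n) (ha : HasDecayingJet a) (hb : HasDecayingJet b) {p : ℝ}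
    (hp : 0 < p)
    (h1 : ∀ z, -dirDeriv (timeDir n) b z + ∑ j, dirDeriv (spaceDir j) (dirDeriv (spaceDir j) a) z =
      (a z * a z + b z * b z) ^ (p / 2) * a z)
    (h2 : ∀ z, dirDeriv (timeDir n) a z + ∑ j, dirDeriv (spaceDir j) (dirDeriv (spaceDir j) b) z =
      (a z * a z + b z * b z) ^ (p / 2) * b z) {T : ℝ} (hT : 0 < T)
    (hper : Periodic (fun t => ∫ x, virialDensity a b (t, x)) T)
    (z : ℝ × EuclideanSpace ℝ (Fin n)) : a z * a z + b z * b z = 0 := by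
  have hd : ∀ t, HasDerivAt (fun t => ∫ x, virialDensity a b (t, x))
      (∫ x, virialProduction p a b (t, x)) t := fun t => by
    rw [← integral_virialDensityDeriv ha hb hp h1 h2]
    exact (uniformExpDecay_virialDensity ha hb).hasDerivAt_integral
      (uniformExpDecay_virialDensityDeriv ha hb) (hasDerivAt_virialDensity ha hb) t
  have hnn : ∀ z, 0 ≤ virialProduction p a b z := virialProduction_nonneg hp
  have hmono : Monotone fun t => ∫ x, virialDensity a b (t, x) :=
    monotone_of_hasDerivAt_nonneg hd fun t => integral_nonneg fun x => hnn (t, x)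
  have hconst : ∀ s t, (∫ x, virialDensity a b (s, x)) = ∫ x, virialDensity a b (t, x) := by
    have key : ∀ s t, (∫ x, virialDensity a b (s, x)) ≤ ∫ x, virialDensity a b (t, x) := by
      intro s t
      obtain ⟨k, hk⟩ := exists_nat_ge ((s - t) / T)
      rw [div_le_iff₀ hT] at hk
      exact (hmono (by linarith : s ≤ t + k * T)).trans_eq (hper.nat_mul k t)
    exact fun s t => (key s t).antisymm (key t s)
  have hzero_int : ∫ x, virialProduction p a b (z.1, x) = 0 :=
    (hd z.1).unique ((hasDerivAt_const z.1 (∫ x, virialDensity a b (z.1, x))).congr_of_eventuallyEq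
      (Filter.Eventually.of_forall fun t => hconst t z.1))
  have hP := uniformExpDecay_virialProduction ha hb hp
  have hc : Continuous fun x => virialProduction p a b (z.1, x) := hP.1.comp (by fun_prop)
  have hzero : virialProduction p a b z = 0 := by
    rw [integral_eq_zero_iff_of_nonneg (fun x => hnn (z.1, x)) (hP.integrable z.1)] at hzero_int
    exact congrFun ((hc.ae_eq_iff_eq volume continuous_const).1 hzero_int) z.2
  have hr : 0 ≤ a z * a z + b z * b z := add_nonneg (mul_self_nonneg _) (mul_self_nonneg _)
  have hc' : 0 < (n : ℝ) * (1 - 2 / (p + 2)) := by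
    have : 1 - 2 / (p + 2) = p / (p + 2) := by field_simp; ring
    rw [this]; positivity
  rw [virialProduction] at hzero
  have h3 := Finset.sum_nonneg fun (j : Fin n) (_ : j ∈ Finset.univ) =>
    add_nonneg (mul_self_nonneg (dirDeriv (spaceDir j) a z))
      (mul_self_nonneg (dirDeriv (spaceDir j) b z))
  have h4 := Real.rpow_nonneg hr (p / 2 + 1)
  have h5 : (a z * a z + b z * b z) ^ (p / 2 + 1) = 0 := by nlinarith
  exact (Real.rpow_eq_zero hr (by positivity)).1 h5

theorem dirDeriv_periodic {V : Type*} [NormedAddCommGroup V] [NormedSpace ℝ V] {f : V → ℝ}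
    {c : V} (hf : Periodic f c) (v : V) : Periodic (dirDeriv v f) c := fun z => by
  rw [dirDeriv, ← fderiv_comp_add_right, funext hf, dirDeriv]

theorem virialDensity_periodic {c : ℝ × EuclideanSpace ℝ (Fin n)} (hc : c.2 = 0)
    (ha : Periodic a c) (hb : Periodic b c) : Periodic (virialDensity a b) c := fun z => by
  simp only [virialDensity, ha z, hb z, dirDeriv_periodic ha _ z, dirDeriv_periodic hb _ z,
    Prod.snd_add, hc, add_zero]

end Virial

section Coordinates

variable {n : ℕ} {u : ℝ → EuclideanSpace ℝ (Fin n) → ℂ}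

theorem hasFDerivAt_slice {E F : Type*} [NormedAddCommGroup E] [NormedSpace ℝ E]
    [NormedAddCommGroup F] [NormedSpace ℝ F] {f : ℝ × E → F} {f' : ℝ × E →L[ℝ] F} {t : ℝ} {x : E}
    (hf : HasFDerivAt f f' (t, x)) :
    HasFDerivAt (fun y => f (t, y)) (f'.comp (ContinuousLinearMap.inr ℝ ℝ E)) x :=
  hf.comp x (hasFDerivAt_prodMk_right t x)

theorem lap_eq_sum_fderiv (hu : ContDiff ℝ (⊤ : ℕ∞) (uncurry u)) (t : ℝ)
    (x : EuclideanSpace ℝ (Fin n)) :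
    lap (u t) x =
      ∑ j, fderiv ℝ (fderiv ℝ (uncurry u)) (t, x) (spaceDir j) (spaceDir j) := by
  have h1 : ∀ (j : Fin n) y, pd (u t) j y = fderiv ℝ (uncurry u) (t, y) (spaceDir j) :=
    fun j y => congrArg (fun L => L (EuclideanSpace.single j 1))
      (hasFDerivAt_slice ((hu.differentiable (by simp)) (t, y)).hasFDerivAt).fderiv
  refine Finset.sum_congr rfl fun j _ => ?_
  simp only [h1]
  exact congrArg (fun L => L (EuclideanSpace.single j 1))
    (hasFDerivAt_slice (hasFDerivAt_fderiv_apply hu (spaceDir j) (t, x))).fderiv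

end Coordinates

/-- **Nonexistence of breathers for the defocusing NLS.**
A smooth, exponentially localized (together with all space-time derivatives of order
at most 2), time-periodic solution of `i ∂ₜ u + Δ u = |u|^p u` is identically zero. -/
theorem no_defocusing_NLS_breather (n : ℕ) (hn : 1 ≤ n) (p : ℝ) (hp : 0 < p)
    (u : ℝ → EuclideanSpace ℝ (Fin n) → ℂ)
    (hsmooth : ContDiff ℝ (⊤ : ℕ∞) (Function.uncurry u))
    (heq : ∀ (t : ℝ) (x : EuclideanSpace ℝ (Fin n)),
      Complex.I * deriv (fun s => u s x) t + lap (u t) x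
        = ((‖u t x‖ ^ p : ℝ) : ℂ) * u t x)
    (hloc : ∃ C > 0, ∃ γ > 0, ∀ k : ℕ, k ≤ 2 → ∀ (t : ℝ) (x : EuclideanSpace ℝ (Fin n)),
      ‖iteratedFDeriv ℝ k (Function.uncurry u) (t, x)‖ ≤ C * Real.exp (-γ * ‖x‖))
    (hper : ∃ T > 0, ∀ (t : ℝ) (x : EuclideanSpace ℝ (Fin n)), u (t + T) x = u t x) :
    ∀ t x, u t x = 0 := by
  obtain ⟨C, -, γ, hγ, hb⟩ := hloc
  obtain ⟨T, hT, hper⟩ := hper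
  have hre := hasDecayingJet_clm_comp hsmooth hγ hb reCLM
  have him := hasDecayingJet_clm_comp hsmooth hγ hb imCLM
  have hpow : ∀ z : ℂ, ‖z‖ ^ p = (z.re * z.re + z.im * z.im) ^ (p / 2) := fun z => by
    rw [← Complex.normSq_apply, Complex.normSq_eq_norm_sq, ← Real.rpow_natCast,
      ← Real.rpow_mul (norm_nonneg z)]
    congr 1
    push_cast
    ring
  have heq' : ∀ z : ℝ × EuclideanSpace ℝ (Fin n),
      Complex.I * fderiv ℝ (uncurry u) z (timeDir n) +
        ∑ j, fderiv ℝ (fderiv ℝ (uncurry u)) z (spaceDir j) (spaceDir j) =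
      (((uncurry u z).re * (uncurry u z).re + (uncurry u z).im * (uncurry u z).im) ^ (p / 2) : ℝ) *
        uncurry u z := by
    rintro ⟨t, x⟩
    rw [← hpow, ← lap_eq_sum_fderiv hsmooth]
    exact (hasDerivAt_time hsmooth t x).deriv ▸ heq t x
  have hperU : Periodic (uncurry u) (T, 0) := fun z => by
    simpa [uncurry] using hper z.1 z.2
  have hperP : Periodic (fun t => ∫ x, virialDensity (fun z => reCLM (uncurry u z))
      (fun z => imCLM (uncurry u z)) (t, x)) T := fun t => by
    refine integral_congr_ae (Filter.Eventually.of_forall fun x => ?_)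
    simpa [Function.comp_def] using virialDensity_periodic
      (c := (T, (0 : EuclideanSpace ℝ (Fin n)))) rfl (hperU.comp reCLM) (hperU.comp imCLM) (t, x)
  intro t x
  have key := eq_zero_of_periodic hn hre him hp (fun z => ?_) (fun z => ?_) hT hperP (t, x)
  · exact Complex.normSq_eq_zero.1 ((Complex.normSq_apply _).trans key)
  · simp only [dirDeriv_clm_comp hsmooth, dirDeriv_dirDeriv_clm_comp hsmooth]
    simpa using congrArg Complex.re (heq' z)
  · simp only [dirDeriv_clm_comp hsmooth, dirDeriv_dirDeriv_clm_comp hsmooth]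
    simpa using congrArg Complex.im (heq' z)
end

section
/- Let n ≥ 1, p > 0 and μ > 0, and let Q : ℝⁿ → ℝ be a smooth solution of the elliptic equation -ΔQ + μQ - |Q|^p Q = 0 such that Q and all its derivatives up to order 2 decay exponentially (there exist C, γ > 0 with |∂^α Q(x)| ≤ C e^{-γ|x|} for |α| ≤ 2). Then the two Pohozaev identities hold: ‖∇Q‖²_{L²} - ‖Q‖^{p+2}_{L^{p+2}} = -μ‖Q‖²_{L²} and (n-2)‖∇Q‖²_{L²} - (2n/(p+2))‖Q‖^{p+2}_{L^{p+2}} = -nμ‖Q‖²_{L²}; consequently ‖∇Q‖²_{L²} = (np/(2(p+2))) ‖Q‖^{p+2}_{L^{p+2}}. -/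
open MeasureTheory Real Function

/-- Partial derivative in the `j`-th coordinate direction (real-valued functions). -/
noncomputable def pdR {n : ℕ} (f : EuclideanSpace ℝ (Fin n) → ℝ) (j : Fin n)
    (x : EuclideanSpace ℝ (Fin n)) : ℝ :=
  fderiv ℝ f x (EuclideanSpace.single j 1)

/-- Laplacian (real-valued functions). -/
noncomputable def lapR {n : ℕ} (f : EuclideanSpace ℝ (Fin n) → ℝ)
    (x : EuclideanSpace ℝ (Fin n)) : ℝ :=
  ∑ j, pdR (fun y => pdR f j y) j x


/-- A continuous function dominated by a decaying exponential of the norm. -/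
structure ContExpDecay {E : Type*} [NormedAddCommGroup E] (f : E → ℝ) : Prop where
  continuous : Continuous f
  bound : ∃ C ≥ 0, ∃ γ > 0, ∀ x, |f x| ≤ C * exp (-γ * ‖x‖)

namespace ContExpDecay

variable {E : Type*} [NormedAddCommGroup E] {f g : E → ℝ}

lemma zero : ContExpDecay (fun _ : E => (0 : ℝ)) :=
  ⟨continuous_const, 0, le_rfl, 1, one_pos, fun x => by simp⟩

lemma add (hf : ContExpDecay f) (hg : ContExpDecay g) : ContExpDecay (fun x => f x + g x) := by
  obtain ⟨hf, C, hC, γ, hγ, hfb⟩ := hf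
  obtain ⟨hg, D, hD, δ, hδ, hgb⟩ := hg
  refine ⟨hf.add hg, C + D, by positivity, min γ δ, lt_min hγ hδ, fun x => ?_⟩
  have h1 : exp (-γ * ‖x‖) ≤ exp (-min γ δ * ‖x‖) := by
    gcongr
    exact min_le_left _ _
  have h2 : exp (-δ * ‖x‖) ≤ exp (-min γ δ * ‖x‖) := by
    gcongr
    exact min_le_right _ _
  calc |f x + g x| ≤ |f x| + |g x| := abs_add_le _ _
    _ ≤ C * exp (-γ * ‖x‖) + D * exp (-δ * ‖x‖) := add_le_add (hfb x) (hgb x)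
    _ ≤ C * exp (-min γ δ * ‖x‖) + D * exp (-min γ δ * ‖x‖) := by gcongr
    _ = _ := by ring

lemma const_mul (c : ℝ) (hf : ContExpDecay f) : ContExpDecay (fun x => c * f x) := by
  obtain ⟨hf, C, hC, γ, hγ, hfb⟩ := hf
  refine ⟨hf.const_mul c, |c| * C, by positivity, γ, hγ, fun x => ?_⟩
  rw [abs_mul, mul_assoc]
  gcongr
  exact hfb x

lemma sub (hf : ContExpDecay f) (hg : ContExpDecay g) : ContExpDecay (fun x => f x - g x) := by
  simpa [sub_eq_add_neg] using hf.add (hg.const_mul (-1))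

lemma mul (hf : ContExpDecay f) (hg : ContExpDecay g) : ContExpDecay (fun x => f x * g x) := by
  obtain ⟨hf, C, hC, γ, hγ, hfb⟩ := hf
  obtain ⟨hg, D, hD, δ, hδ, hgb⟩ := hg
  refine ⟨hf.mul hg, C * D, by positivity, γ + δ, by positivity, fun x => ?_⟩
  calc |f x * g x| = |f x| * |g x| := abs_mul _ _
    _ ≤ (C * exp (-γ * ‖x‖)) * (D * exp (-δ * ‖x‖)) :=
      mul_le_mul (hfb x) (hgb x) (abs_nonneg _) (by positivity)
    _ = C * D * (exp (-γ * ‖x‖) * exp (-δ * ‖x‖)) := by ring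
    _ = _ := by rw [← exp_add]; ring_nf

lemma sq (hf : ContExpDecay f) : ContExpDecay (fun x => f x ^ 2) := by
  simpa [pow_two] using hf.mul hf

lemma sum {ι : Type*} {s : Finset ι} {f : ι → E → ℝ} (hf : ∀ i ∈ s, ContExpDecay (f i)) :
    ContExpDecay (fun x => ∑ i ∈ s, f i x) := by
  classical
  induction s using Finset.induction_on with
  | empty => simpa using zero
  | insert a s ha ih =>
    simp only [Finset.sum_insert ha]
    exact (hf a (by simp)).add (ih fun i hi => hf i (by simp [hi]))

lemma rpow {r : ℝ} (hr : 0 < r) (hf : ContExpDecay f) : ContExpDecay (fun x => |f x| ^ r) := by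
  obtain ⟨hf, C, hC, γ, hγ, hfb⟩ := hf
  refine ⟨hf.abs.rpow_const fun _ => Or.inr hr.le, C ^ r, by positivity, γ * r, by positivity,
    fun x => ?_⟩
  rw [abs_of_nonneg (by positivity)]
  calc |f x| ^ r ≤ (C * exp (-γ * ‖x‖)) ^ r :=
        rpow_le_rpow (abs_nonneg _) (hfb x) hr.le
    _ = C ^ r * exp (-γ * ‖x‖) ^ r := mul_rpow hC (exp_pos _).le
    _ = _ := by rw [← exp_mul]; ring_nf

/-- Linear growth does not destroy exponential decay. -/
lemma linear_mul (hg : Continuous g) (hgb : ∀ x, |g x| ≤ ‖x‖) (hf : ContExpDecay f) :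
    ContExpDecay (fun x => g x * f x) := by
  obtain ⟨hf, C, hC, γ, hγ, hfb⟩ := hf
  refine ⟨hg.mul hf, 2 / γ * C, by positivity, γ / 2, by positivity, fun x => ?_⟩
  have h1 : ‖x‖ ≤ 2 / γ * exp (γ / 2 * ‖x‖) := by
    have := add_one_le_exp (γ / 2 * ‖x‖)
    calc ‖x‖ = 2 / γ * (γ / 2 * ‖x‖) := by field_simp
      _ ≤ _ := by gcongr; linarith
  calc |g x * f x| = |g x| * |f x| := abs_mul _ _
    _ ≤ (2 / γ * exp (γ / 2 * ‖x‖)) * (C * exp (-γ * ‖x‖)) :=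
      mul_le_mul ((hgb x).trans h1) (hfb x) (abs_nonneg _) (by positivity)
    _ = 2 / γ * C * (exp (γ / 2 * ‖x‖) * exp (-γ * ‖x‖)) := by ring
    _ = _ := by rw [← exp_add]; ring_nf

lemma integrable [NormedSpace ℝ E] [FiniteDimensional ℝ E] [MeasurableSpace E] [BorelSpace E]
    {ν : Measure E} [ν.IsAddHaarMeasure] (hf : ContExpDecay f) : Integrable f ν := by
  obtain ⟨hf, C, hC, γ, hγ, hfb⟩ := hf
  set m : ℕ := Module.finrank ℝ E + 1 with hm
  have hint : Integrable (fun x : E => (1 + ‖x‖) ^ (-(m : ℝ))) ν :=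
    integrable_one_add_norm (by rw [hm]; push_cast; linarith)
  refine (hint.const_mul (C * (m.factorial * exp γ / γ ^ m))).mono' hf.aestronglyMeasurable
    (.of_forall fun x => ?_)
  have h1 := pow_div_factorial_le_exp (γ * (1 + ‖x‖)) (by positivity) m
  have h2 : exp (-γ * ‖x‖) ≤ m.factorial * exp γ / γ ^ m * (1 + ‖x‖) ^ (-(m : ℝ)) := by
    rw [rpow_neg (by positivity), rpow_natCast, neg_mul, exp_neg]
    rw [mul_add, mul_one, exp_add, div_le_iff₀ (by positivity)] at h1
    rw [← div_eq_mul_inv, div_div, le_div_iff₀ (by positivity), inv_mul_le_iff₀ (exp_pos _)]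
    calc _ = (γ + γ * ‖x‖) ^ m := by rw [← mul_pow]; ring
      _ ≤ _ := h1
      _ = _ := by ring
  calc ‖f x‖ ≤ C * exp (-γ * ‖x‖) := hfb x
    _ ≤ C * (m.factorial * exp γ / γ ^ m * (1 + ‖x‖) ^ (-(m : ℝ))) := by gcongr
    _ = _ := by ring

/-- The integral of a directional derivative of a decaying function vanishes. -/
lemma integral_lineDeriv_eq_zero [NormedSpace ℝ E] [FiniteDimensional ℝ E] [MeasurableSpace E]
    [BorelSpace E] {ν : Measure E} [ν.IsAddHaarMeasure] {v : E} (hf : ContExpDecay f)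
    (hg : ContExpDecay g) (h : ∀ x, HasLineDerivAt ℝ f (g x) x v) : ∫ x, g x ∂ν = 0 := by
  simpa using integral_bilinear_hasLineDerivAt_right_eq_neg_left_of_integrable
    (μ := ν) (f := fun _ : E => (1 : ℝ)) (f' := fun _ => (0 : ℝ)) (g := f) (g' := g) (v := v)
    (B := ContinuousLinearMap.mul ℝ ℝ) (by simp) (by simpa using hg.integrable)
    (by simpa using hf.integrable)
    (fun x _ => by simpa [HasLineDerivAt] using hasDerivAt_const (0 : ℝ) (1 : ℝ)) (fun x _ => h x)

end ContExpDecay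

lemma HasLineDerivAt.hasDerivAt_line {E : Type*} [NormedAddCommGroup E] [NormedSpace ℝ E]
    {f : E → ℝ} {f' : ℝ} {x v : E} (h : HasLineDerivAt ℝ f f' x v) :
    HasDerivAt (fun t : ℝ => f (x + t • v)) f' 0 :=
  h

section Pohozaev

variable {n : ℕ} {Q : EuclideanSpace ℝ (Fin n) → ℝ}

lemma Differentiable.hasLineDerivAt_pdR (hQ : Differentiable ℝ Q) (j : Fin n)
    (x : EuclideanSpace ℝ (Fin n)) :
    HasLineDerivAt ℝ Q (pdR Q j x) x (EuclideanSpace.single j 1) :=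
  (hQ x).hasFDerivAt.hasLineDerivAt _

lemma hasLineDerivAt_coord (j k : Fin n) (x : EuclideanSpace ℝ (Fin n)) :
    HasLineDerivAt ℝ (fun y : EuclideanSpace ℝ (Fin n) => y j) (if j = k then 1 else 0) x
      (EuclideanSpace.single k 1) := by
  have h := (EuclideanSpace.proj j : EuclideanSpace ℝ (Fin n) →L[ℝ] ℝ).hasFDerivAt
    (x := x) |>.hasLineDerivAt (EuclideanSpace.single k 1)
  simpa [Pi.single_apply] using h

lemma pdR_pdR_eq_fderiv_fderiv (hQ : ContDiff ℝ (⊤ : ℕ∞) Q) (j k : Fin n)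
    (x : EuclideanSpace ℝ (Fin n)) :
    pdR (pdR Q j) k x =
      fderiv ℝ (fderiv ℝ Q) x (EuclideanSpace.single k 1) (EuclideanSpace.single j 1) := by
  have h : DifferentiableAt ℝ (fderiv ℝ Q) x :=
    (hQ.fderiv_right (m := (⊤ : ℕ∞)) (by simp)).differentiable (by simp) x
  have h' := (h.hasFDerivAt.clm_apply
    (hasFDerivAt_const (EuclideanSpace.single j (1 : ℝ)) x)).fderiv
  change fderiv ℝ (fun y => fderiv ℝ Q y (EuclideanSpace.single j 1)) x _ = _
  rw [h']
  simp

lemma pdR_pdR_comm (hQ : ContDiff ℝ (⊤ : ℕ∞) Q) (j k : Fin n) (x : EuclideanSpace ℝ (Fin n)) :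
    pdR (pdR Q j) k x = pdR (pdR Q k) j x := by
  rw [pdR_pdR_eq_fderiv_fderiv hQ, pdR_pdR_eq_fderiv_fderiv hQ]
  have h2 : ContDiff ℝ 2 Q := contDiff_infty.mp hQ 2
  exact (h2.contDiffAt.isSymmSndFDerivAt (by simp)).eq _ _

lemma contDiff_pdR (hQ : ContDiff ℝ (⊤ : ℕ∞) Q) (j : Fin n) : ContDiff ℝ (⊤ : ℕ∞) (pdR Q j) :=
  (hQ.fderiv_right (by simp)).clm_apply contDiff_const

end Pohozaev

/-- **Pohozaev identities for ground states.**  If `Q` is a smooth, exponentially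
decaying (up to second derivatives) solution of `-ΔQ + μQ - |Q|^p Q = 0` with `μ > 0`,
then `‖∇Q‖² - ‖Q‖^{p+2}_{L^{p+2}} = -μ‖Q‖²`, `(n-2)‖∇Q‖² - (2n/(p+2))‖Q‖^{p+2}_{L^{p+2}}
= -nμ‖Q‖²` and consequently `‖∇Q‖² = (np/(2(p+2))) ‖Q‖^{p+2}_{L^{p+2}}`. -/
theorem pohozaev_identities (n : ℕ) (hn : 1 ≤ n) (p μ : ℝ) (hp : 0 < p) (hμ : 0 < μ)
    (Q : EuclideanSpace ℝ (Fin n) → ℝ)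
    (hQ : ContDiff ℝ (⊤ : ℕ∞) Q)
    (heq : ∀ x, -lapR Q x + μ * Q x - |Q x| ^ p * Q x = 0)
    (hdec : ∃ C > 0, ∃ γ > 0, ∀ k : ℕ, k ≤ 2 → ∀ x,
      ‖iteratedFDeriv ℝ k Q x‖ ≤ C * Real.exp (-γ * ‖x‖)) :
    ((∫ x, ∑ j, (pdR Q j x) ^ 2) - (∫ x, |Q x| ^ (p + 2))
        = -μ * ∫ x, (Q x) ^ 2) ∧
    (((n : ℝ) - 2) * (∫ x, ∑ j, (pdR Q j x) ^ 2)
        - (2 * (n : ℝ) / (p + 2)) * (∫ x, |Q x| ^ (p + 2))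
        = -(n : ℝ) * μ * ∫ x, (Q x) ^ 2) ∧
    ((∫ x, ∑ j, (pdR Q j x) ^ 2)
        = ((n : ℝ) * p / (2 * (p + 2))) * ∫ x, |Q x| ^ (p + 2)) := by
  obtain ⟨C, hC, γ, hγ, hb⟩ := hdec
  have hQd : ContExpDecay Q := ⟨hQ.continuous, C, hC.le, γ, hγ, fun x => by
    simpa using hb 0 (by norm_num) x⟩
  have hd (j : Fin n) : ContExpDecay (pdR Q j) :=
    ⟨(contDiff_pdR hQ j).continuous, C, hC.le, γ, hγ, fun x => by
      have h := (fderiv ℝ Q x).le_opNorm (EuclideanSpace.single j 1)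
      rw [← norm_iteratedFDeriv_one] at h
      simpa [pdR] using h.trans (by simpa using hb 1 (by norm_num) x)⟩
  have hdd (j k : Fin n) : ContExpDecay (pdR (pdR Q j) k) :=
    ⟨(contDiff_pdR (contDiff_pdR hQ j) k).continuous, C, hC.le, γ, hγ, fun x => by
      have h := (fderiv ℝ (fderiv ℝ Q) x).le_opNorm₂ (EuclideanSpace.single k 1)
        (EuclideanSpace.single j 1)
      rw [← norm_iteratedFDeriv_one, norm_iteratedFDeriv_fderiv,
        ← pdR_pdR_eq_fderiv_fderiv hQ] at h
      simpa using h.trans (by simpa using hb 2 le_rfl x)⟩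
  have hx (j : Fin n) {f : EuclideanSpace ℝ (Fin n) → ℝ} (hf : ContExpDecay f) :
      ContExpDecay (fun x => x j * f x) :=
    hf.linear_mul (by fun_prop) fun x => PiLp.norm_apply_le x j
  have hdQ (k : Fin n) (x : EuclideanSpace ℝ (Fin n)) :=
    (hQ.differentiable (by simp)).hasLineDerivAt_pdR k x
  have hdd' (j k : Fin n) (x : EuclideanSpace ℝ (Fin n)) :=
    ((contDiff_pdR hQ j).differentiable (by simp)).hasLineDerivAt_pdR k x
  have hp2 : ContExpDecay (fun x => |Q x| ^ (p + 2)) := hQd.rpow (by linarith)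
  have hpQ : ContExpDecay (fun x => |Q x| ^ p * Q x) := (hQd.rpow hp).mul hQd
  have hgrad : ContExpDecay (fun x => ∑ j, pdR Q j x ^ 2) := .sum fun j _ => (hd j).sq
  have hrpow (x) : |Q x| ^ (p + 2) = |Q x| ^ p * Q x ^ 2 := by
    rw [rpow_add_of_nonneg (abs_nonneg _) hp.le (by norm_num)]
    norm_num
  have hlap (x) : ∑ j, pdR (pdR Q j) j x = μ * Q x - |Q x| ^ p * Q x := by
    have := heq x
    rw [lapR] at this
    linarith
  have hnehari : (∫ x, ∑ j, (pdR Q j x) ^ 2) - (∫ x, |Q x| ^ (p + 2))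
      = -μ * ∫ x, (Q x) ^ 2 := by
    have hk (k : Fin n) : ContExpDecay fun x => pdR Q k x * pdR Q k x + Q x * pdR (pdR Q k) k x :=
      ((hd k).mul (hd k)).add (hQd.mul (hdd k k))
    have h0 (k : Fin n) : ∫ x, (pdR Q k x * pdR Q k x + Q x * pdR (pdR Q k) k x) = 0 :=
      (hQd.mul (hd k)).integral_lineDeriv_eq_zero (v := EuclideanSpace.single k 1) (hk k) fun x => by
        refine HasDerivAt.congr_deriv
          ((hdQ k x).hasDerivAt_line.mul (hdd' k k x).hasDerivAt_line) ?_
        simp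
    have hsum : ∫ x, ((∑ j, pdR Q j x ^ 2) - |Q x| ^ (p + 2) + μ * Q x ^ 2) = 0 := by
      rw [← Finset.sum_eq_zero fun k (_ : k ∈ Finset.univ) => h0 k,
        ← integral_finsetSum _ fun k _ => (hk k).integrable]
      congr with x
      rw [Finset.sum_add_distrib, ← Finset.mul_sum, hlap, hrpow]
      simp only [pow_two]
      ring
    rw [integral_add (hgrad.sub hp2).integrable (hQd.sq.const_mul μ).integrable,
      integral_sub hgrad.integrable hp2.integrable, integral_const_mul] at hsum
    linarith
  have hpohozaev : ((n : ℝ) - 2) * (∫ x, ∑ j, (pdR Q j x) ^ 2)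
        - (2 * (n : ℝ) / (p + 2)) * (∫ x, |Q x| ^ (p + 2))
        = -(n : ℝ) * μ * ∫ x, (Q x) ^ 2 := by
    let e (x : EuclideanSpace ℝ (Fin n)) : ℝ :=
      (1 / 2) * (∑ j, pdR Q j x ^ 2) + (μ / 2) * Q x ^ 2 - (1 / (p + 2)) * |Q x| ^ (p + 2)
    let e' (k : Fin n) (x : EuclideanSpace ℝ (Fin n)) : ℝ :=
      (∑ j, pdR Q j x * pdR (pdR Q j) k x) + μ * (Q x * pdR Q k x)
        - |Q x| ^ p * Q x * pdR Q k x
    let r (x : EuclideanSpace ℝ (Fin n)) : ℝ := ∑ j, x j * pdR Q j x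
    let r' (k : Fin n) (x : EuclideanSpace ℝ (Fin n)) : ℝ :=
      pdR Q k x + ∑ j, x j * pdR (pdR Q j) k x
    have he : ContExpDecay e :=
      ((hgrad.const_mul _).add (hQd.sq.const_mul _)).sub (hp2.const_mul _)
    have he' (k : Fin n) : ContExpDecay (e' k) :=
      ((ContExpDecay.sum fun j _ => (hd j).mul (hdd j k)).add
        ((hQd.mul (hd k)).const_mul _)).sub (hpQ.mul (hd k))
    have hr : ContExpDecay r := .sum fun j _ => hx j (hd j)
    have hr' (k : Fin n) : ContExpDecay (r' k) := (hd k).add (.sum fun j _ => hx j (hdd j k))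
    have hde (k : Fin n) (x) : HasLineDerivAt ℝ e (e' k x) x (EuclideanSpace.single k 1) := by
      have h1 := HasDerivAt.fun_sum (u := Finset.univ)
        fun j _ => (hdd' j k x).hasDerivAt_line.fun_pow 2
      have h2 := (hdQ k x).hasDerivAt_line.fun_pow 2
      have h3 := HasDerivAt.comp (0 : ℝ) (hasDerivAt_abs_rpow
        (Q (x + (0 : ℝ) • EuclideanSpace.single k 1)) (show 1 < p + 2 by linarith))
        (hdQ k x).hasDerivAt_line
      have h := ((h1.const_mul (1 / 2)).add (h2.const_mul (μ / 2))).sub (h3.const_mul (1 / (p + 2)))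
      refine HasDerivAt.congr_deriv h ?_
      have hp0 : p + 2 ≠ 0 := by linarith
      simp only [e', zero_smul, add_zero, Finset.mul_sum, add_sub_cancel_right]
      congr 1
      · congr 1
        · refine Finset.sum_congr rfl fun j _ => ?_
          push_cast
          ring
        · push_cast
          ring
      · field_simp
    have hdr (k : Fin n) (x) : HasLineDerivAt ℝ r (r' k x) x (EuclideanSpace.single k 1) := by
      have h := HasDerivAt.fun_sum (u := Finset.univ)
        fun j _ => (hasLineDerivAt_coord j k x).hasDerivAt_line.fun_mul (hdd' j k x).hasDerivAt_line
      refine HasDerivAt.congr_deriv h ?_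
      simp [r', Finset.sum_add_distrib]
    have hk (k : Fin n) : ContExpDecay fun x =>
        (r' k x * pdR Q k x + r x * pdR (pdR Q k) k x) - (e x + x k * e' k x) :=
      (((hr' k).mul (hd k)).add (hr.mul (hdd k k))).sub (he.add (hx k (he' k)))
    have h0 (k : Fin n) : ∫ x,
        ((r' k x * pdR Q k x + r x * pdR (pdR Q k) k x) - (e x + x k * e' k x)) = 0 :=
      ((hr.mul (hd k)).sub (hx k he)).integral_lineDeriv_eq_zero (v := EuclideanSpace.single k 1) (hk k) fun x => by
        refine HasDerivAt.congr_deriv (((hdr k x).hasDerivAt_line.mul (hdd' k k x).hasDerivAt_line).sub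
          ((hasLineDerivAt_coord k k x).hasDerivAt_line.mul (hde k x).hasDerivAt_line)) ?_
        simp
    have hsum : ∫ x, ((∑ j, pdR Q j x ^ 2) - n * e x) = 0 := by
      rw [← Finset.sum_eq_zero fun k (_ : k ∈ Finset.univ) => h0 k,
        ← integral_finsetSum _ fun k _ => (hk k).integrable]
      congr with x
      have hcross : ∑ k, (∑ j, x j * pdR (pdR Q j) k x) * pdR Q k x
          = ∑ k, x k * ∑ j, pdR Q j x * pdR (pdR Q j) k x := by
        simp only [Finset.sum_mul, Finset.mul_sum]
        rw [Finset.sum_comm]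
        refine Finset.sum_congr rfl fun j _ => Finset.sum_congr rfl fun k _ => ?_
        rw [pdR_pdR_comm hQ]
        ring
      have h1 : ∑ k, r' k x * pdR Q k x = (∑ k, pdR Q k x ^ 2)
          + ∑ k, x k * ∑ j, pdR Q j x * pdR (pdR Q j) k x := by
        rw [← hcross, ← Finset.sum_add_distrib]
        exact Finset.sum_congr rfl fun k _ => by simp only [r']; ring
      have h2 : ∑ k, x k * e' k x = (∑ k, x k * ∑ j, pdR Q j x * pdR (pdR Q j) k x)
          + r x * (μ * Q x - |Q x| ^ p * Q x) := by
        simp only [r]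
        rw [Finset.sum_mul, ← Finset.sum_add_distrib]
        exact Finset.sum_congr rfl fun k _ => by simp only [e']; ring
      rw [Finset.sum_sub_distrib, Finset.sum_add_distrib, Finset.sum_add_distrib,
        ← Finset.mul_sum, hlap, h1, h2]
      simp only [Finset.sum_const, Finset.card_univ, Fintype.card_fin, nsmul_eq_mul]
      ring
    simp only [e] at hsum
    rw [integral_sub hgrad.integrable (he.const_mul n).integrable, integral_const_mul,
      integral_sub ((hgrad.const_mul _).add (hQd.sq.const_mul _)).integrable
        (hp2.const_mul _).integrable,
      integral_add (hgrad.const_mul _).integrable (hQd.sq.const_mul _).integrable,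
      integral_const_mul, integral_const_mul, integral_const_mul] at hsum
    linear_combination (-2) * hsum
  refine ⟨hnehari, hpohozaev, ?_⟩
  have hp0 : p + 2 ≠ 0 := by linarith
  field_simp at hpohozaev ⊢
  linear_combination (p + 2) * n * hnehari - hpohozaev
end
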